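/- Let 0 < α < 1, 0 < β < 1, and τ > 0, and let w(ζ) = [ 1 + ((1−ζ)/τ)^α · ((2−α)/(2−2α))^{1−α} · (1 − (α/(2−α)) ζ)^{1−α} ]^{−β}, which is analytic in a complex neighborhood of ζ = 0 (using principal-branch powers). Let w_j = w^{(j)}(0)/j! be its Taylor coefficients at 0. Then the sequence (w_0, w_1, w_2, …) is completely monotonic: for all integers j, k ≥ 0, Σ_{n=0}^k (−1)^n (k choose n) w_{n+j} ≥ 0. -/

import Mathlib

open Finset

/-- The complex plane slit along `[1, ∞)`. -/
def slitDomain : Set ℂ := {ζ | 1 - ζ ∈ Complex.slitPlane}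

/-- The conformal map of the unit disc onto the plane slit along `[1, ∞)`. -/
noncomputable def koebe (z : ℂ) : ℂ := 4 * z / (1 + z) ^ 2

/-- The polynomial to which the difference kernel pulls back under `koebe`. -/
noncomputable def diffKernel (j k : ℕ) (u : ℂ) : ℂ :=
  ((1 + u) ^ 2 / 4) ^ j * (-(1 - u) ^ 2 / 4) ^ k * ((1 - u ^ 2) / 4)

lemma isOpen_slitDomain : IsOpen slitDomain :=
  Complex.isOpen_slitPlane.preimage (by fun_prop : Continuous fun ζ : ℂ => 1 - ζ)

lemma zero_mem_slitDomain : (0 : ℂ) ∈ slitDomain := by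
  simp [slitDomain]

lemma slitDomain_mem_nhds_zero : slitDomain ∈ nhds (0 : ℂ) :=
  isOpen_slitDomain.mem_nhds zero_mem_slitDomain

lemma one_add_ne_zero_of_norm_lt_one {z : ℂ} (hz : ‖z‖ < 1) : 1 + z ≠ 0 := by
  intro h
  have : z = -1 := by linear_combination h
  simp [this] at hz

lemma sq_mem_slitPlane {x : ℂ} (hx : 0 < x.re) : x ^ 2 ∈ Complex.slitPlane := by
  rw [Complex.mem_slitPlane_iff, pow_two, Complex.mul_re, Complex.mul_im]
  by_cases h : x.im = 0
  · left
    rw [h]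
    nlinarith
  · right
    have : x.re * x.im ≠ 0 := mul_ne_zero hx.ne' h
    intro h'
    apply this
    linarith

lemma koebe_mem_slitDomain {z : ℂ} (hz : ‖z‖ < 1) : koebe z ∈ slitDomain := by
  have h1 := one_add_ne_zero_of_norm_lt_one hz
  have h2 : 1 - koebe z = ((1 - z) / (1 + z)) ^ 2 := by
    unfold koebe
    field_simp
    ring
  have h3 : (1 - z) / (1 + z) = (1 - z) * (starRingEnd ℂ) (1 + z)
      * (((Complex.normSq (1 + z))⁻¹ : ℝ) : ℂ) := by
    rw [div_eq_mul_inv, Complex.inv_def, mul_assoc]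
  have h4 : 0 < Complex.normSq (1 + z) := Complex.normSq_pos.mpr h1
  have h5 : Complex.normSq z < 1 := by
    rw [Complex.normSq_eq_norm_sq]
    nlinarith [norm_nonneg z]
  change 1 - koebe z ∈ Complex.slitPlane
  rw [h2]
  apply sq_mem_slitPlane
  rw [h3, Complex.re_mul_ofReal]
  refine mul_pos ?_ (inv_pos.mpr h4)
  rw [Complex.normSq_apply] at h5
  simp
  nlinarith

lemma koebe_im (z : ℂ) :
    (koebe z).im = 4 * (z.im * (1 - Complex.normSq z)) * ((Complex.normSq (1 + z))⁻¹) ^ 2 := by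
  have h3 : koebe z = 4 * (z * (starRingEnd ℂ) (1 + z) ^ 2)
      * ((((Complex.normSq (1 + z))⁻¹) ^ 2 : ℝ) : ℂ) := by
    unfold koebe
    rw [div_eq_mul_inv, ← inv_pow, Complex.inv_def]
    push_cast
    ring
  rw [h3, Complex.im_mul_ofReal]
  congr 1
  simp [Complex.normSq_apply, pow_two]
  ring

lemma koebe_im_neg {z : ℂ} (hz : ‖z‖ < 1) (him : z.im < 0) : (koebe z).im < 0 := by
  have h4 : 0 < Complex.normSq (1 + z) :=
    Complex.normSq_pos.mpr (one_add_ne_zero_of_norm_lt_one hz)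
  have h5 : Complex.normSq z < 1 := by
    rw [Complex.normSq_eq_norm_sq]
    nlinarith [norm_nonneg z]
  rw [koebe_im]
  have : 0 < ((Complex.normSq (1 + z))⁻¹) ^ 2 := by positivity
  nlinarith [mul_pos (neg_pos.mpr him) (sub_pos.mpr h5)]

lemma koebe_conj (z : ℂ) : koebe ((starRingEnd ℂ) z) = (starRingEnd ℂ) (koebe z) := by
  simp [koebe, map_ofNat]

lemma hasDerivAt_koebe {z : ℂ} (hz : 1 + z ≠ 0) :
    HasDerivAt koebe (4 * (1 - z) / (1 + z) ^ 3) z := by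
  have h := ((hasDerivAt_id z).const_mul 4).div (((hasDerivAt_id z).const_add 1).pow 2)
    (pow_ne_zero 2 hz)
  refine h.congr_deriv ?_
  simp only [id]
  field_simp
  simp
  ring

lemma koebe_ne_zero {z : ℂ} (hz : ‖z‖ < 1) (h0 : z ≠ 0) : koebe z ≠ 0 :=
  div_ne_zero (mul_ne_zero (by norm_num) h0) (pow_ne_zero 2 (one_add_ne_zero_of_norm_lt_one hz))

lemma differentiableAt_comp_koebe {f : ℂ → ℂ} (hf : DifferentiableOn ℂ f slitDomain) {z : ℂ}
    (hz : ‖z‖ < 1) : DifferentiableAt ℂ (fun z => f (koebe z)) z := by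
  have h1 := hf.differentiableAt (isOpen_slitDomain.mem_nhds (koebe_mem_slitDomain hz))
  exact h1.comp z (hasDerivAt_koebe (one_add_ne_zero_of_norm_lt_one hz)).differentiableAt

lemma differentiableAt_koebe_deriv {z : ℂ} (hz : ‖z‖ < 1) :
    DifferentiableAt ℂ (fun z : ℂ => 4 * (1 - z) / (1 + z) ^ 3) z := by
  have h := pow_ne_zero 3 (one_add_ne_zero_of_norm_lt_one hz)
  fun_prop (disch := exact h)

lemma circleIntegral_eq_zero_of_differentiableAt {f : ℂ → ℂ} {r : ℝ} (hr : 0 ≤ r) (hr1 : r < 1)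
    (hf : ∀ z, ‖z‖ < 1 → DifferentiableAt ℂ f z) : (∮ z in C(0, r), f z) = 0 := by
  apply Complex.circleIntegral_eq_zero_of_differentiable_on_off_countable hr Set.countable_empty
  · intro z hz
    exact (hf z (by simp at hz; linarith)).continuousAt.continuousWithinAt
  · intro z hz
    exact hf z (by simp at hz; linarith)

lemma circleIntegral_koebe_inv {r : ℝ} (hr : 0 < r) (hr1 : r < 1) :
    (∮ z in C(0, r), (koebe z)⁻¹ * (4 * (1 - z) / (1 + z) ^ 3)) = 2 * Real.pi * Complex.I := by
  have h1 : (∮ z in C(0, r), (koebe z)⁻¹ * (4 * (1 - z) / (1 + z) ^ 3))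
      = ∮ z in C(0, r), ((z - 0)⁻¹ + -2 / (1 + z)) := by
    apply circleIntegral.integral_congr hr.le
    intro z hz
    have hz' : ‖z‖ = r := by simpa using hz
    have h0 : z ≠ 0 := by
      rintro rfl
      simp at hz'
      linarith
    have h1 := one_add_ne_zero_of_norm_lt_one (hz'.trans_lt hr1)
    simp only [koebe]
    field_simp
    ring
  rw [h1, circleIntegral.integral_add, circleIntegral.integral_sub_center_inv _ hr.ne',
    circleIntegral_eq_zero_of_differentiableAt hr.le hr1, add_zero]
  · intro z hz
    have h := one_add_ne_zero_of_norm_lt_one hz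
    fun_prop (disch := exact h)
  · rw [circleIntegrable_sub_inv_iff]
    right
    simp [abs_of_pos hr, hr.ne]
  · apply ContinuousOn.circleIntegrable hr.le
    intro z hz
    have h := one_add_ne_zero_of_norm_lt_one (z := z) (by simp at hz; linarith)
    exact ContinuousAt.continuousWithinAt (by fun_prop (disch := exact h))

lemma circleIntegral_koebe_inv_pow {r : ℝ} (hr : 0 < r) (hr1 : r < 1) (n : ℕ) :
    (∮ z in C(0, r), ((koebe z) ^ (n + 2))⁻¹ * (4 * (1 - z) / (1 + z) ^ 3)) = 0 := by
  apply circleIntegral.integral_eq_zero_of_hasDerivWithinAt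
    (f := fun z => -((n : ℂ) + 1)⁻¹ * ((koebe z) ^ (n + 1))⁻¹) hr.le
  intro z hz
  have hz' : ‖z‖ = r := by simpa using hz
  have h0 : z ≠ 0 := by
    rintro rfl
    simp at hz'
    linarith
  have hk := koebe_ne_zero (hz'.trans_lt hr1) h0
  have h := hasDerivAt_koebe (one_add_ne_zero_of_norm_lt_one (hz'.trans_lt hr1))
  have hn : (n : ℂ) + 1 ≠ 0 := by exact_mod_cast n.succ_ne_zero
  refine HasDerivAt.hasDerivWithinAt
    ((((h.pow (n + 1)).inv (pow_ne_zero _ hk)).const_mul _).congr_deriv ?_)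
  rw [Pi.pow_apply]
  push_cast
  field_simp
  ring

lemma continuousOn_koebe_integrand {f : ℂ → ℂ} (hf : DifferentiableOn ℂ f slitDomain) {r : ℝ}
    (hr : 0 < r) (hr1 : r < 1) (n : ℕ) :
    ContinuousOn (fun z => f (koebe z) * ((koebe z) ^ n)⁻¹ * (4 * (1 - z) / (1 + z) ^ 3))
      (Metric.sphere 0 r) := by
  intro z hz
  have hz' : ‖z‖ = r := by simpa using hz
  have hz1 := hz'.trans_lt hr1
  have h0 : z ≠ 0 := by
    rintro rfl
    simp at hz'
    linarith
  have hk := pow_ne_zero n (koebe_ne_zero hz1 h0)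
  have h := (hasDerivAt_koebe (one_add_ne_zero_of_norm_lt_one hz1)).continuousAt
  exact (((differentiableAt_comp_koebe hf hz1).continuousAt.mul ((h.pow n).inv₀ hk)).mul
    (differentiableAt_koebe_deriv hz1).continuousAt).continuousWithinAt

lemma circleIntegral_koebe_eq_coeff {r : ℝ} (hr : 0 < r) (hr1 : r < 1) (j : ℕ) {f : ℂ → ℂ}
    {p : FormalMultilinearSeries ℂ ℂ ℂ} (hf : DifferentiableOn ℂ f slitDomain)
    (hp : HasFPowerSeriesAt f p 0) :
    (∮ z in C(0, r), f (koebe z) * ((koebe z) ^ (j + 1))⁻¹ * (4 * (1 - z) / (1 + z) ^ 3))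
      = 2 * Real.pi * Complex.I * p.coeff j := by
  induction j generalizing f p with
  | zero =>
    have hg := (Complex.differentiableOn_dslope slitDomain_mem_nhds_zero).2 hf
    have h1 : (∮ z in C(0, r), f (koebe z) * ((koebe z) ^ (0 + 1))⁻¹
          * (4 * (1 - z) / (1 + z) ^ 3))
        = ∮ z in C(0, r), (f 0 * ((koebe z)⁻¹ * (4 * (1 - z) / (1 + z) ^ 3))
          + dslope f 0 (koebe z) * (4 * (1 - z) / (1 + z) ^ 3)) := by
      apply circleIntegral.integral_congr hr.le
      intro z hz
      have hz' : ‖z‖ = r := by simpa using hz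
      have hk := koebe_ne_zero (hz'.trans_lt hr1) (by rintro rfl; simp at hz'; linarith)
      have h := sub_smul_dslope f 0 (koebe z)
      simp only [sub_zero, smul_eq_mul] at h
      have h' : f (koebe z) = f 0 + koebe z * dslope f 0 (koebe z) := by rw [h]; ring
      simp only [h']
      field_simp
      ring
    rw [h1, circleIntegral.integral_add, circleIntegral.integral_const_mul,
      circleIntegral_koebe_inv hr hr1,
      circleIntegral_eq_zero_of_differentiableAt hr.le hr1, add_zero, mul_comm]
    · congr 1
      exact (hp.coeff_zero 1).symm
    · intro z hz
      exact (differentiableAt_comp_koebe hg hz).mul (differentiableAt_koebe_deriv hz)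
    · apply ContinuousOn.circleIntegrable hr.le
      have := continuousOn_koebe_integrand (f := fun _ => f 0) (differentiableOn_const _) hr hr1 1
      simpa [mul_assoc] using this
    · apply ContinuousOn.circleIntegrable hr.le
      simpa using continuousOn_koebe_integrand hg hr hr1 0
  | succ j ih =>
    have hg := (Complex.differentiableOn_dslope slitDomain_mem_nhds_zero).2 hf
    have h1 : (∮ z in C(0, r), f (koebe z) * ((koebe z) ^ (j + 1 + 1))⁻¹
          * (4 * (1 - z) / (1 + z) ^ 3))
        = ∮ z in C(0, r), (f 0 * (((koebe z) ^ (j + 2))⁻¹ * (4 * (1 - z) / (1 + z) ^ 3))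
          + dslope f 0 (koebe z) * ((koebe z) ^ (j + 1))⁻¹ * (4 * (1 - z) / (1 + z) ^ 3)) := by
      apply circleIntegral.integral_congr hr.le
      intro z hz
      have hz' : ‖z‖ = r := by simpa using hz
      have hk := koebe_ne_zero (hz'.trans_lt hr1) (by rintro rfl; simp at hz'; linarith)
      have h := sub_smul_dslope f 0 (koebe z)
      simp only [sub_zero, smul_eq_mul] at h
      have h' : f (koebe z) = f 0 + koebe z * dslope f 0 (koebe z) := by rw [h]; ring
      simp only [h']
      field_simp
      ring
    rw [h1, circleIntegral.integral_add, circleIntegral.integral_const_mul,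
      circleIntegral_koebe_inv_pow hr hr1, mul_zero, zero_add,
      ih hg hp.has_fpower_series_dslope_fslope, FormalMultilinearSeries.coeff_fslope]
    · apply ContinuousOn.circleIntegrable hr.le
      have := continuousOn_koebe_integrand (f := fun _ => f 0) (differentiableOn_const _) hr hr1
        (j + 2)
      simpa [mul_assoc] using this
    · exact (continuousOn_koebe_integrand hg hr hr1 (j + 1)).circleIntegrable hr.le

lemma differentiable_diffKernel (j k : ℕ) : Differentiable ℂ (diffKernel j k) := by
  unfold diffKernel
  fun_prop

lemma circleIntegral_diffKernel_eq_sum_coeff {r : ℝ} (hr : 0 < r) (hr1 : r < 1) (j k : ℕ)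
    {f : ℂ → ℂ} {p : FormalMultilinearSeries ℂ ℂ ℂ} (hf : DifferentiableOn ℂ f slitDomain)
    (hp : HasFPowerSeriesAt f p 0) :
    (∮ z in C(0, r), koebe z * f (koebe z) * diffKernel j k z * (z ^ (j + k + 2))⁻¹)
      = 2 * Real.pi * Complex.I
        * ∑ n ∈ range (k + 1), (-1 : ℂ) ^ n * (Nat.choose k n : ℂ) * p.coeff (n + j) := by
  have h1 : (∮ z in C(0, r), koebe z * f (koebe z) * diffKernel j k z * (z ^ (j + k + 2))⁻¹)
      = ∮ z in C(0, r), ∑ n ∈ range (k + 1), (-1 : ℂ) ^ n * (Nat.choose k n : ℂ) *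
        (f (koebe z) * ((koebe z) ^ (n + j + 1))⁻¹ * (4 * (1 - z) / (1 + z) ^ 3)) := by
    apply circleIntegral.integral_congr hr.le
    intro z hz
    have hz' : ‖z‖ = r := by simpa using hz
    have h0 : z ≠ 0 := by
      rintro rfl
      simp at hz'
      linarith
    have hk := koebe_ne_zero (hz'.trans_lt hr1) h0
    have h1 := one_add_ne_zero_of_norm_lt_one (hz'.trans_lt hr1)
    have hsum : ∑ n ∈ range (k + 1), (-1 : ℂ) ^ n * (Nat.choose k n : ℂ) *
        (f (koebe z) * ((koebe z) ^ (n + j + 1))⁻¹ * (4 * (1 - z) / (1 + z) ^ 3))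
        = f (koebe z) * ((koebe z) ^ (j + 1))⁻¹ * (4 * (1 - z) / (1 + z) ^ 3)
          * (-(koebe z)⁻¹ + 1) ^ k := by
      rw [add_pow (-(koebe z)⁻¹), Finset.mul_sum]
      refine Finset.sum_congr rfl fun n _ => ?_
      rw [neg_pow (koebe z)⁻¹ n, add_assoc n, pow_add, mul_inv, inv_pow, one_pow]
      ring
    have hinv : (koebe z)⁻¹ = (1 + z) ^ 2 / 4 / z := by
      unfold koebe
      field_simp
    have hbase : -(koebe z)⁻¹ + 1 = -(1 - z) ^ 2 / 4 / z := by
      rw [hinv]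
      field_simp
      ring
    have hder : koebe z * ((koebe z)⁻¹ * (koebe z)⁻¹ * (4 * (1 - z) / (1 + z) ^ 3))
        = koebe z * ((1 - z ^ 2) / 4 / z ^ 2) := by
      rw [hinv]
      field_simp
      ring
    have hder' : (koebe z)⁻¹ * (4 * (1 - z) / (1 + z) ^ 3)
        = koebe z * ((1 - z ^ 2) / 4 / z ^ 2) := by
      rw [← hder]
      field_simp
    simp only [hsum]
    rw [hbase, pow_succ (koebe z) j, mul_inv, ← inv_pow]
    calc _ = f (koebe z) * ((1 + z) ^ 2 / 4 / z) ^ j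
          * (koebe z * ((1 - z ^ 2) / 4 / z ^ 2)) * (-(1 - z) ^ 2 / 4 / z) ^ k := by
            rw [diffKernel, pow_add, pow_add]
            generalize (1 + z) ^ 2 / 4 = X
            generalize -(1 - z) ^ 2 / 4 = Y
            ring
      _ = _ := by
            rw [← hder', ← hinv]
            ring
  rw [h1, circleIntegral.integral_fun_sum, Finset.mul_sum]
  · refine Finset.sum_congr rfl fun n _ => ?_
    rw [circleIntegral.integral_const_mul, circleIntegral_koebe_eq_coeff hr hr1 _ hf hp]
    ring
  · intro n _
    apply ContinuousOn.circleIntegrable hr.le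
    exact continuousOn_const.mul (continuousOn_koebe_integrand hf hr hr1 _)

lemma diffKernel_exp (j k : ℕ) (θ : ℝ) :
    diffKernel j k (Complex.exp (θ * Complex.I)) = Complex.exp (θ * Complex.I) ^ (j + k + 1)
      * (-Complex.I * ((((1 + Real.cos θ) / 2) ^ j * ((1 - Real.cos θ) / 2) ^ k
        * (Real.sin θ / 2) : ℝ) : ℂ)) := by
  have hcs := Complex.cos_sq_add_sin_sq (θ : ℂ)
  rw [Complex.exp_mul_I]
  push_cast
  set c := Complex.cos θ
  set s := Complex.sin θ
  have h1 : (1 + (c + s * Complex.I)) ^ 2 / 4 = (c + s * Complex.I) * ((1 + c) / 2) := by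
    linear_combination (-(1 : ℂ) / 4) * hcs + s ^ 2 / 4 * Complex.I_sq
  have h2 : -(1 - (c + s * Complex.I)) ^ 2 / 4 = (c + s * Complex.I) * ((1 - c) / 2) := by
    linear_combination ((1 : ℂ) / 4) * hcs - s ^ 2 / 4 * Complex.I_sq
  have h3 : (1 - (c + s * Complex.I) ^ 2) / 4
      = (c + s * Complex.I) * (-Complex.I * (s / 2)) := by
    linear_combination (-(1 : ℂ) / 4) * hcs + s ^ 2 / 4 * Complex.I_sq
  rw [diffKernel, h1, h2, h3, mul_pow, mul_pow]
  ring

lemma circleIntegral_diffKernel_mul (j k : ℕ) (H : ℂ → ℂ) {s : ℝ} (hs : 0 < s) :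
    (∮ z in C(0, s⁻¹), H z * diffKernel j k (s * z) * (z ^ (j + k + 2))⁻¹)
      = (s : ℂ) ^ (j + k + 1) * ∫ θ in (0 : ℝ)..2 * Real.pi, H (circleMap 0 s⁻¹ θ) *
        ((((1 + Real.cos θ) / 2) ^ j * ((1 - Real.cos θ) / 2) ^ k * (Real.sin θ / 2) : ℝ) : ℂ) := by
  rw [circleIntegral, ← intervalIntegral.integral_const_mul]
  apply intervalIntegral.integral_congr
  intro θ _
  have hs' : (s : ℂ) ≠ 0 := by exact_mod_cast hs.ne'
  have h1 : (s : ℂ) * circleMap 0 s⁻¹ θ = Complex.exp (θ * Complex.I) := by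
    rw [circleMap_zero]
    push_cast
    field_simp
  simp only [deriv_circleMap, smul_eq_mul]
  rw [h1, diffKernel_exp, ← h1, mul_pow]
  have hz : circleMap 0 s⁻¹ θ ≠ 0 := by
    simpa using circleMap_ne_center (c := 0) (inv_pos.mpr hs).ne' (θ := θ)
  generalize ((((1 + Real.cos θ) / 2) ^ j * ((1 - Real.cos θ) / 2) ^ k
    * (Real.sin θ / 2) : ℝ) : ℂ) = B
  rw [pow_succ (circleMap 0 s⁻¹ θ) (j + k + 1)]
  generalize circleMap 0 s⁻¹ θ = z at hz
  field_simp
  linear_combination (-B * H z) * Complex.I_sq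

lemma conj_circleMap_eq_two_pi_sub (r θ : ℝ) :
    (starRingEnd ℂ) (circleMap 0 r θ) = circleMap 0 r (2 * Real.pi - θ) := by
  rw [circleMap_zero, circleMap_zero, map_mul, ← Complex.exp_conj]
  have : ((2 * Real.pi - θ : ℝ) : ℂ) * Complex.I
      = (starRingEnd ℂ) (θ * Complex.I) + 2 * Real.pi * Complex.I := by
    simp
    ring
  rw [this, Complex.exp_periodic]
  simp

/-- A function real on the real axis, with nonpositive imaginary part on the lower half disc, has
purely imaginary integral with nonnegative imaginary part against the difference kernel. -/
lemma integral_sin_kernel (j k : ℕ) {H : ℂ → ℂ} {r : ℝ} (hr : 0 < r) (hr1 : r < 1)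
    (hH : ∀ z, ‖z‖ < 1 → ContinuousAt H z)
    (hconj : ∀ z, ‖z‖ < 1 → H ((starRingEnd ℂ) z) = (starRingEnd ℂ) (H z))
    (him : ∀ z, ‖z‖ < 1 → z.im < 0 → (H z).im ≤ 0) :
    (∫ θ in (0 : ℝ)..2 * Real.pi, H (circleMap 0 r θ) *
        ((((1 + Real.cos θ) / 2) ^ j * ((1 - Real.cos θ) / 2) ^ k
          * (Real.sin θ / 2) : ℝ) : ℂ)).re = 0 ∧
    0 ≤ (∫ θ in (0 : ℝ)..2 * Real.pi, H (circleMap 0 r θ) *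
        ((((1 + Real.cos θ) / 2) ^ j * ((1 - Real.cos θ) / 2) ^ k
          * (Real.sin θ / 2) : ℝ) : ℂ)).im := by
  have hn : ∀ θ, ‖circleMap 0 r θ‖ < 1 := fun θ => by simpa [abs_of_pos hr] using hr1
  have hcont : Continuous fun θ : ℝ => H (circleMap 0 r θ) *
        ((((1 + Real.cos θ) / 2) ^ j * ((1 - Real.cos θ) / 2) ^ k
          * (Real.sin θ / 2) : ℝ) : ℂ) := by
    refine Continuous.mul ?_ (by fun_prop)
    refine continuous_iff_continuousAt.2 fun θ => ?_
    exact ContinuousAt.comp (f := circleMap 0 r) (hH _ (hn θ))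
      (continuous_circleMap 0 r).continuousAt
  have hint := hcont.intervalIntegrable (μ := MeasureTheory.volume) 0 (2 * Real.pi)
  constructor
  · have h := intervalIntegral.intervalIntegral_re hint
    simp only [RCLike.re_to_complex] at h
    rw [← h]
    set F : ℝ → ℝ := fun θ => (H (circleMap 0 r θ) *
        ((((1 + Real.cos θ) / 2) ^ j * ((1 - Real.cos θ) / 2) ^ k
          * (Real.sin θ / 2) : ℝ) : ℂ)).re with hF
    have h2 := intervalIntegral.integral_comp_sub_left (a := 0) (b := 2 * Real.pi) F (2 * Real.pi)
    have h3 : (fun θ => F (2 * Real.pi - θ)) = fun θ => -F θ := by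
      funext θ
      simp only [hF]
      rw [← conj_circleMap_eq_two_pi_sub, hconj _ (hn θ), Real.cos_two_pi_sub, Real.sin_two_pi_sub,
        Complex.re_mul_ofReal, Complex.re_mul_ofReal, Complex.conj_re]
      ring
    rw [h3, intervalIntegral.integral_neg] at h2
    simp only [sub_self, sub_zero] at h2
    linarith
  · have h := intervalIntegral.intervalIntegral_im hint
    simp only [RCLike.im_to_complex] at h
    rw [← h]
    apply intervalIntegral.integral_nonneg (by positivity)
    intro θ _
    rw [Complex.im_mul_ofReal]
    have hc1 : 0 ≤ ((1 + Real.cos θ) / 2) ^ j :=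
      pow_nonneg (by linarith [Real.neg_one_le_cos θ]) _
    have hc2 : 0 ≤ ((1 - Real.cos θ) / 2) ^ k :=
      pow_nonneg (by linarith [Real.cos_le_one θ]) _
    have hsin : 0 ≤ (H (circleMap 0 r θ)).im * Real.sin θ := by
      rcases lt_trichotomy (Real.sin θ) 0 with hs | hs | hs
      · have := him _ (hn θ) (by rw [circleMap_zero_im]; exact mul_neg_of_pos_of_neg hr hs)
        exact mul_nonneg_of_nonpos_of_nonpos this hs.le
      · simp [hs]
      · have := him ((starRingEnd ℂ) (circleMap 0 r θ)) (by simpa using hn θ)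
          (by rw [Complex.conj_im, circleMap_zero_im]; nlinarith [mul_pos hr hs])
        rw [hconj _ (hn θ), Complex.conj_im] at this
        exact mul_nonneg (by linarith) hs.le
    have := mul_nonneg (mul_nonneg hc1 hc2) hsin
    linarith

lemma differences_nonneg_of_im_mul_nonpos {f : ℂ → ℂ} {p : FormalMultilinearSeries ℂ ℂ ℂ}
    (hf : DifferentiableOn ℂ f slitDomain) (hp : HasFPowerSeriesAt f p 0)
    (hconj : ∀ ζ ∈ slitDomain, f ((starRingEnd ℂ) ζ) = (starRingEnd ℂ) (f ζ))
    (him : ∀ ζ : ℂ, ζ.im < 0 → (ζ * f ζ).im ≤ 0) (j k : ℕ) :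
    (∑ n ∈ range (k + 1), (-1 : ℂ) ^ n * (Nat.choose k n : ℂ) * p.coeff (n + j)).im = 0 ∧
    0 ≤ (∑ n ∈ range (k + 1), (-1 : ℂ) ^ n * (Nat.choose k n : ℂ) * p.coeff (n + j)).re := by
  set H : ℂ → ℂ := fun z => koebe z * f (koebe z) with hH
  have hHd : ∀ z, ‖z‖ < 1 → DifferentiableAt ℂ H z := fun z hz =>
    (hasDerivAt_koebe (one_add_ne_zero_of_norm_lt_one hz)).differentiableAt.mul
      (differentiableAt_comp_koebe hf hz)
  have hHconj : ∀ z, ‖z‖ < 1 → H ((starRingEnd ℂ) z) = (starRingEnd ℂ) (H z) := fun z hz => by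
    simp only [hH]
    rw [koebe_conj, hconj _ (koebe_mem_slitDomain hz), map_mul]
  have hHim : ∀ z, ‖z‖ < 1 → z.im < 0 → (H z).im ≤ 0 := fun z hz hz' =>
    him _ (koebe_im_neg hz hz')
  set J : ℝ → ℂ := fun s =>
    ∮ z in C(0, 1 / 2), H z * diffKernel j k (s * z) * (z ^ (j + k + 2))⁻¹ with hJ
  have hn : ∀ θ, ‖circleMap 0 (1 / 2) θ‖ < 1 := fun θ => by
    simp [abs_of_pos]
    norm_num
  have hJc : Continuous J := by
    simp only [hJ, circleIntegral]
    apply intervalIntegral.continuous_parametric_intervalIntegral_of_continuous'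
    have hc : Continuous fun θ => H (circleMap 0 (1 / 2) θ) :=
      continuous_iff_continuousAt.2 fun θ => ContinuousAt.comp (f := circleMap 0 (1 / 2))
        (hHd _ (hn θ)).continuousAt (continuous_circleMap 0 _).continuousAt
    have hk := (differentiable_diffKernel j k).continuous
    have hm := continuous_circleMap 0 (1 / 2)
    have hinv : Continuous fun θ => ((circleMap 0 (1 / 2) θ) ^ (j + k + 2))⁻¹ :=
      (hm.pow _).inv₀ fun θ => pow_ne_zero _ (by simp)
    simp only [deriv_circleMap, smul_eq_mul, Function.uncurry_def]
    exact ((hm.comp continuous_snd).mul continuous_const).mul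
      (((hc.comp continuous_snd).mul (hk.comp ((Complex.continuous_ofReal.comp continuous_fst).mul
        (hm.comp continuous_snd)))).mul (hinv.comp continuous_snd))
  have hJs : ∀ s ∈ Set.Ioo (1 : ℝ) 2, J s ∈ {x : ℂ | x.re = 0 ∧ 0 ≤ x.im} := by
    intro s ⟨hs1, hs2⟩
    have hs0 : 0 < s := by linarith
    have hsi : s⁻¹ < 1 := inv_lt_one_of_one_lt₀ hs1
    have hd : ∀ z, ‖z‖ < 1 → z ≠ 0 → DifferentiableAt ℂ
        (fun z => H z * diffKernel j k (s * z) * (z ^ (j + k + 2))⁻¹) z := by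
      intro z hz hz0
      refine ((hHd z hz).mul ?_).mul ((differentiableAt_id.pow _).inv (pow_ne_zero _ hz0))
      exact (differentiable_diffKernel j k).differentiableAt.comp z
        (differentiableAt_id.const_mul _)
    have hJ' : J s = ∮ z in C(0, s⁻¹), H z * diffKernel j k (s * z) * (z ^ (j + k + 2))⁻¹ := by
      symm
      apply Complex.circleIntegral_eq_of_differentiable_on_annulus_off_countable (by norm_num) _
        Set.countable_empty
      · intro z hz
        refine (hd z ?_ ?_).continuousAt.continuousWithinAt
        · have := hz.1
          simp at this
          linarith
        · rintro rfl
          exact hz.2 (by simp)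
      · intro z hz
        refine hd z ?_ ?_
        · have := hz.1.1
          simp at this
          linarith
        · rintro rfl
          exact hz.1.2 (by simp)
      · rw [one_div]
        exact inv_anti₀ hs0 hs2.le
    have hI := integral_sin_kernel j k (inv_pos.mpr hs0) hsi
      (fun z hz => (hHd z hz).continuousAt) hHconj hHim
    rw [hJ', circleIntegral_diffKernel_mul j k H hs0, ← Complex.ofReal_pow, Set.mem_ofPred_eq,
      Complex.re_ofReal_mul, Complex.im_ofReal_mul, hI.1]
    exact ⟨mul_zero _, mul_nonneg (by positivity) hI.2⟩
  have hclosed : IsClosed {x : ℂ | x.re = 0 ∧ 0 ≤ x.im} :=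
    (isClosed_eq Complex.continuous_re continuous_const).inter
      (isClosed_le continuous_const Complex.continuous_im)
  have hJ1 : J 1 ∈ {x : ℂ | x.re = 0 ∧ 0 ≤ x.im} := by
    refine hclosed.mem_of_tendsto (hJc.continuousAt.tendsto.mono_left nhdsWithin_le_nhds)
      (b := nhdsWithin 1 (Set.Ioi 1)) ?_
    filter_upwards [Ioo_mem_nhdsGT (show (1 : ℝ) < 2 by norm_num)] with s hs using hJs s hs
  have hJS := circleIntegral_diffKernel_eq_sum_coeff (r := 1 / 2) (by norm_num) (by norm_num)
    j k hf hp
  have hJ1' : J 1 = ((2 * Real.pi : ℝ) : ℂ) * (Complex.I *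
      ∑ n ∈ range (k + 1), (-1 : ℂ) ^ n * (Nat.choose k n : ℂ) * p.coeff (n + j)) := by
    simp only [hJ, hH, Complex.ofReal_one, one_mul]
    rw [hJS]
    push_cast
    ring
  rw [hJ1', Set.mem_ofPred_eq, Complex.re_ofReal_mul, Complex.im_ofReal_mul, Complex.I_mul_re,
    Complex.I_mul_im] at hJ1
  have hpi : 0 < 2 * Real.pi := by positivity
  constructor
  · have := (mul_eq_zero.1 hJ1.1).resolve_left hpi.ne'
    linarith
  · exact nonneg_of_mul_nonneg_right hJ1.2 hpi

lemma arg_mem_Ioo_of_im_pos {x : ℂ} (hx : 0 < x.im) : x.arg ∈ Set.Ioo 0 Real.pi := by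
  constructor
  · refine lt_of_le_of_ne (Complex.arg_nonneg_iff.2 hx.le) fun h => ?_
    exact hx.ne' (Complex.arg_eq_zero_iff.1 h.symm).2
  · exact Complex.arg_lt_pi_iff.2 (Or.inr hx.ne')

lemma arg_one_add_le {x : ℂ} (hx : 0 < x.im) : (1 + x).arg ≤ x.arg := by
  have hx1 : 0 < (1 + x).im := by simpa using hx
  obtain ⟨h1, h2⟩ := arg_mem_Ioo_of_im_pos hx
  obtain ⟨h3, h4⟩ := arg_mem_Ioo_of_im_pos hx1
  have hsin : ‖x‖ * ‖1 + x‖ * Real.sin (x.arg - (1 + x).arg) = x.im := by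
    have e1 := Complex.norm_mul_cos_arg x
    have e2 := Complex.norm_mul_sin_arg x
    have e3 := Complex.norm_mul_cos_arg (1 + x)
    have e4 := Complex.norm_mul_sin_arg (1 + x)
    rw [Real.sin_sub]
    calc _ = (‖x‖ * Real.sin x.arg) * (‖1 + x‖ * Real.cos (1 + x).arg)
          - (‖x‖ * Real.cos x.arg) * (‖1 + x‖ * Real.sin (1 + x).arg) := by ring
      _ = x.im := by
        rw [e1, e2, e3, e4]
        simp
        ring
  by_contra! h
  have := Real.sin_neg_of_neg_of_neg_pi_lt (x := x.arg - (1 + x).arg) (by linarith) (by linarith)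
  have := mul_nonpos_of_nonneg_of_nonpos
    (mul_nonneg (norm_nonneg x) (norm_nonneg (1 + x))) this.le
  linarith

lemma one_sub_mul_mem_slitPlane {a : ℝ} (ha0 : 0 < a) (ha1 : a < 1) {ζ : ℂ}
    (hζ : ζ ∈ slitDomain) : 1 - (a : ℂ) * ζ ∈ Complex.slitPlane := by
  have hζ' : 1 - ζ ∈ Complex.slitPlane := hζ
  rw [Complex.mem_slitPlane_iff] at hζ' ⊢
  simp only [Complex.sub_re, Complex.one_re, Complex.sub_im, Complex.one_im, zero_sub,
    Complex.re_ofReal_mul, Complex.im_ofReal_mul] at hζ' ⊢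
  rcases hζ' with h | h
  · left
    nlinarith
  · right
    simp only [neg_ne_zero] at h ⊢
    exact mul_ne_zero ha0.ne' h

lemma div_ofReal_mem_slitPlane {τ : ℝ} (hτ : 0 < τ) {x : ℂ} (hx : x ∈ Complex.slitPlane) :
    x / (τ : ℂ) ∈ Complex.slitPlane := by
  rw [Complex.mem_slitPlane_iff] at hx ⊢
  rw [Complex.div_ofReal_re, Complex.div_ofReal_im]
  rcases hx with h | h
  · exact Or.inl (div_pos h hτ)
  · exact Or.inr (div_ne_zero h hτ.ne')

/-- The symbol `(x/τ)^α c^(1-α) y^(1-α)`, with principal powers. -/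
noncomputable def geomSymbol (α τ c : ℝ) (x y : ℂ) : ℂ :=
  (x / (τ : ℂ)) ^ (α : ℂ) * (c : ℂ) ^ ((1 - α : ℝ) : ℂ) * y ^ ((1 - α : ℝ) : ℂ)

lemma geomSymbol_eq_exp {α τ c : ℝ} (hc : 0 < c) (hτ : 0 < τ) {x y : ℂ}
    (hx : x ∈ Complex.slitPlane) (hy : y ∈ Complex.slitPlane) :
    ∃ L : ℂ, geomSymbol α τ c x y = Complex.exp L ∧
      L.im = α * x.arg + (1 - α) * y.arg := by
  have hc' : (c : ℂ) ≠ 0 := by exact_mod_cast hc.ne'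
  have hx' := Complex.slitPlane_ne_zero (div_ofReal_mem_slitPlane hτ hx)
  refine ⟨Complex.log (x / (τ : ℂ)) * (α : ℂ) + Complex.log c * ((1 - α : ℝ) : ℂ)
    + Complex.log y * ((1 - α : ℝ) : ℂ), ?_, ?_⟩
  · rw [geomSymbol, Complex.cpow_def_of_ne_zero hx', Complex.cpow_def_of_ne_zero hc',
      Complex.cpow_def_of_ne_zero (Complex.slitPlane_ne_zero hy), Complex.exp_add, Complex.exp_add]
  · have harg : (x / (τ : ℂ)).arg = x.arg := by
      rw [div_eq_inv_mul, ← Complex.ofReal_inv, Complex.arg_real_mul _ (inv_pos.mpr hτ)]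
    simp only [Complex.add_im, Complex.im_mul_ofReal, Complex.log_im, harg,
      Complex.arg_ofReal_of_nonneg hc.le]
    ring

lemma geomSymbol_conj (α τ c : ℝ) (hc : 0 < c) (hτ : 0 < τ) {x y : ℂ}
    (hx : x ∈ Complex.slitPlane) (hy : y ∈ Complex.slitPlane) :
    geomSymbol α τ c ((starRingEnd ℂ) x) ((starRingEnd ℂ) y)
      = (starRingEnd ℂ) (geomSymbol α τ c x y) := by
  have hx' := Complex.slitPlane_arg_ne_pi (div_ofReal_mem_slitPlane hτ hx)
  have hc' : (c : ℂ).arg ≠ Real.pi := by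
    rw [Complex.arg_ofReal_of_nonneg hc.le]
    exact Real.pi_ne_zero.symm
  have h1 := Complex.conj_cpow _ (α : ℂ) hx'
  have h2 := Complex.conj_cpow _ ((1 - α : ℝ) : ℂ) hc'
  have h3 := Complex.conj_cpow _ ((1 - α : ℝ) : ℂ) (Complex.slitPlane_arg_ne_pi hy)
  rw [Complex.conj_ofReal] at h1 h2 h3
  rw [Complex.conj_ofReal] at h2
  rw [map_div₀, Complex.conj_ofReal] at h1
  rw [geomSymbol, geomSymbol, map_mul, map_mul, ← h1, ← h2, ← h3]

lemma exp_im_pos {L : ℂ} (h0 : 0 < L.im) (h1 : L.im < Real.pi) : 0 < (Complex.exp L).im := by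
  rw [Complex.exp_im]
  exact mul_pos (Real.exp_pos _) (Real.sin_pos_of_pos_of_lt_pi h0 h1)

lemma geomSymbol_of_im_pos {α τ c : ℝ} (hα0 : 0 < α) (hα1 : α < 1) (hc : 0 < c) (hτ : 0 < τ)
    {x y : ℂ} (hx : 0 < x.im) (hy : 0 < y.im) :
    0 < (geomSymbol α τ c x y).im ∧
      (geomSymbol α τ c x y).arg = α * x.arg + (1 - α) * y.arg := by
  obtain ⟨hx1, hx2⟩ := arg_mem_Ioo_of_im_pos hx
  obtain ⟨hy1, hy2⟩ := arg_mem_Ioo_of_im_pos hy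
  obtain ⟨L, hL, hLim⟩ := geomSymbol_eq_exp (α := α) hc hτ
    (Complex.mem_slitPlane_iff.2 (Or.inr hx.ne')) (Complex.mem_slitPlane_iff.2 (Or.inr hy.ne'))
  have h0 : 0 < L.im := by
    rw [hLim]
    nlinarith [mul_pos hα0 hx1, mul_pos (sub_pos.2 hα1) hy1]
  have h1 : L.im < Real.pi := by
    rw [hLim]
    nlinarith [mul_lt_mul_of_pos_left hx2 hα0, mul_lt_mul_of_pos_left hy2 (sub_pos.2 hα1)]
  rw [hL]
  refine ⟨exp_im_pos h0 h1, ?_⟩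
  rw [← Complex.log_im, Complex.log_exp (by linarith [Real.pi_pos]) h1.le, hLim]

lemma one_add_geomSymbol_mem_slitPlane {α τ c a : ℝ} (hα0 : 0 < α) (hα1 : α < 1) (hc : 0 < c)
    (hτ : 0 < τ) (ha0 : 0 < a) (ha1 : a < 1) {ζ : ℂ} (hζ : ζ ∈ slitDomain) :
    1 + geomSymbol α τ c (1 - ζ) (1 - (a : ℂ) * ζ) ∈ Complex.slitPlane := by
  have hx : 1 - ζ ∈ Complex.slitPlane := hζ
  have hy := one_sub_mul_mem_slitPlane ha0 ha1 hζ
  rcases lt_trichotomy ζ.im 0 with h | h | h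
  · have := (geomSymbol_of_im_pos hα0 hα1 hc hτ (x := 1 - ζ) (y := 1 - (a : ℂ) * ζ)
      (by simpa using h) (by simpa using mul_neg_of_pos_of_neg ha0 h)).1
    exact Complex.mem_slitPlane_iff.2 (Or.inr (by simpa using this.ne'))
  · obtain ⟨L, hL, hLim⟩ := geomSymbol_eq_exp (α := α) hc hτ hx hy
    have hargx : (1 - ζ).arg = 0 := by
      rw [Complex.arg_eq_zero_iff]
      have := Complex.mem_slitPlane_iff.1 hx
      simp only [Complex.sub_im, Complex.one_im, h, sub_self, ne_eq, not_true_eq_false,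
        or_false] at this ⊢
      exact ⟨this.le, trivial⟩
    have hargy : (1 - (a : ℂ) * ζ).arg = 0 := by
      rw [Complex.arg_eq_zero_iff]
      have := Complex.mem_slitPlane_iff.1 hy
      simp only [Complex.sub_im, Complex.one_im, Complex.im_ofReal_mul, h, mul_zero, sub_self,
        ne_eq, not_true_eq_false, or_false] at this ⊢
      exact ⟨this.le, trivial⟩
    rw [hargx, hargy] at hLim
    refine Complex.mem_slitPlane_iff.2 (Or.inl ?_)
    rw [hL, Complex.add_re, Complex.exp_re, hLim]
    simp
    positivity
  · have := (geomSymbol_of_im_pos hα0 hα1 hc hτ (x := (starRingEnd ℂ) (1 - ζ))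
      (y := (starRingEnd ℂ) (1 - (a : ℂ) * ζ))
      (by simpa using h) (by simpa using mul_pos ha0 h)).1
    rw [geomSymbol_conj α τ c hc hτ hx hy, Complex.conj_im] at this
    refine Complex.mem_slitPlane_iff.2 (Or.inr ?_)
    simp only [Complex.add_im, Complex.one_im, zero_add]
    linarith

lemma mul_cpow_geomSymbol_im_nonpos {α β τ c a : ℝ} (hα0 : 0 < α) (hα1 : α < 1) (hβ0 : 0 < β)
    (hβ1 : β < 1) (hc : 0 < c) (hτ : 0 < τ) (ha0 : 0 < a) {ζ : ℂ} (hζ : ζ.im < 0) :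
    (ζ * (1 + geomSymbol α τ c (1 - ζ) (1 - (a : ℂ) * ζ)) ^ (-(β : ℂ))).im ≤ 0 := by
  have hn : 0 < (-ζ).im := by simpa using hζ
  have han : 0 < ((a : ℂ) * (-ζ)).im := by
    rw [Complex.im_ofReal_mul]
    exact mul_pos ha0 hn
  have hx : (1 - ζ).arg ≤ (-ζ).arg := by
    have := arg_one_add_le hn
    rwa [← sub_eq_add_neg] at this
  have hy : (1 - (a : ℂ) * ζ).arg ≤ (-ζ).arg := by
    have := arg_one_add_le han
    rwa [Complex.arg_real_mul _ ha0, mul_neg, ← sub_eq_add_neg] at this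
  obtain ⟨hg, hgarg⟩ := geomSymbol_of_im_pos hα0 hα1 hc hτ (x := 1 - ζ) (y := 1 - (a : ℂ) * ζ)
    (by simpa using hζ) (by simpa using mul_neg_of_pos_of_neg ha0 hζ)
  set g := geomSymbol α τ c (1 - ζ) (1 - (a : ℂ) * ζ)
  have hg1 : 0 < (1 + g).im := by simpa using hg
  have hle : (1 + g).arg ≤ (-ζ).arg := by
    refine (arg_one_add_le hg).trans ?_
    rw [hgarg]
    nlinarith [mul_le_mul_of_nonneg_left hx hα0.le,
      mul_le_mul_of_nonneg_left hy (sub_pos.2 hα1).le]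
  obtain ⟨h1, h2⟩ := arg_mem_Ioo_of_im_pos hg1
  obtain ⟨h3, h4⟩ := arg_mem_Ioo_of_im_pos hn
  have hne : 1 + g ≠ 0 := fun h => by simp [h] at hg1
  have hne' : -ζ ≠ 0 := fun h => by simp [h] at hn
  have hexp : -ζ * (1 + g) ^ (-(β : ℂ))
      = Complex.exp (Complex.log (-ζ) - (β : ℂ) * Complex.log (1 + g)) := by
    rw [Complex.cpow_def_of_ne_zero hne, sub_eq_add_neg, Complex.exp_add, Complex.exp_log hne']
    ring_nf
  have him : 0 ≤ (-ζ * (1 + g) ^ (-(β : ℂ))).im := by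
    rw [hexp, Complex.exp_im]
    refine mul_nonneg (Real.exp_pos _).le (Real.sin_nonneg_of_nonneg_of_le_pi ?_ ?_)
    · simp only [Complex.sub_im, Complex.log_im, Complex.im_ofReal_mul]
      nlinarith
    · simp only [Complex.sub_im, Complex.log_im, Complex.im_ofReal_mul]
      nlinarith
  rw [neg_mul, Complex.neg_im] at him
  linarith

/-- The Taylor coefficients at `0` of the second-order CQ generating function
`w ζ = [1 + ((1-ζ)/τ)^α ((2-α)/(2-2α))^{1-α} (1 - (α/(2-α))ζ)^{1-α}]^{-β}`
(principal-branch powers) form a completely monotonic (real) sequence: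
all finite backward differences `Σ_{n=0}^k (-1)^n C(k,n) w_{n+j}` are
real and nonnegative. -/
theorem stmt15 (α β τ : ℝ) (hα0 : 0 < α) (hα1 : α < 1) (hβ0 : 0 < β) (hβ1 : β < 1)
    (hτ : 0 < τ)
    (w : ℂ → ℂ)
    (hw : w = fun ζ : ℂ =>
      ((1 : ℂ) + (((1 : ℂ) - ζ) / (τ : ℂ)) ^ (α : ℂ)
          * (((2 - α) / (2 - 2 * α) : ℝ) : ℂ) ^ ((1 - α : ℝ) : ℂ)
          * ((1 : ℂ) - ((α / (2 - α) : ℝ) : ℂ) * ζ) ^ ((1 - α : ℝ) : ℂ))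
        ^ (-(β : ℂ)))
    (wseq : ℕ → ℂ)
    (hwseq : ∀ j : ℕ, wseq j = iteratedDeriv j w 0 / (Nat.factorial j : ℂ)) :
    ∀ j k : ℕ,
      (∑ n ∈ range (k + 1), (-1 : ℂ) ^ n * (Nat.choose k n : ℂ) * wseq (n + j)).im = 0 ∧
      0 ≤ (∑ n ∈ range (k + 1), (-1 : ℂ) ^ n * (Nat.choose k n : ℂ) * wseq (n + j)).re := by
  set c : ℝ := (2 - α) / (2 - 2 * α) with hc_def
  set a : ℝ := α / (2 - α) with ha_def
  have hc : 0 < c := div_pos (by linarith) (by linarith)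
  have ha0 : 0 < a := div_pos hα0 (by linarith)
  have ha1 : a < 1 := by
    rw [ha_def, div_lt_one (by linarith)]
    linarith
  have hwg : w = fun ζ : ℂ =>
      (1 + geomSymbol α τ c (1 - ζ) (1 - (a : ℂ) * ζ)) ^ (-(β : ℂ)) := hw
  have hdiff : DifferentiableOn ℂ w slitDomain := by
    intro ζ hζ
    have h1 := one_add_geomSymbol_mem_slitPlane hα0 hα1 hc hτ ha0 ha1 hζ
    have h2 := div_ofReal_mem_slitPlane hτ (x := 1 - ζ) hζ
    have h3 := one_sub_mul_mem_slitPlane ha0 ha1 hζ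
    rw [hwg]
    refine DifferentiableAt.differentiableWithinAt (DifferentiableAt.cpow_const ?_ h1)
    unfold geomSymbol
    refine DifferentiableAt.const_add _ (DifferentiableAt.mul (DifferentiableAt.mul_const ?_ _) ?_)
    · exact DifferentiableAt.cpow_const (by fun_prop) h2
    · exact DifferentiableAt.cpow_const (by fun_prop) h3
  have hconj : ∀ ζ ∈ slitDomain, w ((starRingEnd ℂ) ζ) = (starRingEnd ℂ) (w ζ) := by
    intro ζ hζ
    have h := Complex.conj_cpow _ (-(β : ℂ)) (Complex.slitPlane_arg_ne_pi
      (one_add_geomSymbol_mem_slitPlane hα0 hα1 hc hτ ha0 ha1 hζ))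
    rw [map_neg, Complex.conj_ofReal, map_add, map_one,
      ← geomSymbol_conj α τ c hc hτ hζ (one_sub_mul_mem_slitPlane ha0 ha1 hζ)] at h
    rw [hwg]
    simp only
    rw [← h]
    simp
  have hp := (hdiff.analyticAt slitDomain_mem_nhds_zero).hasFPowerSeriesAt
  intro j k
  have h := differences_nonneg_of_im_mul_nonpos hdiff hp hconj (fun ζ hζ => by
    rw [hwg]
    exact mul_cpow_geomSymbol_im_nonpos hα0 hα1 hβ0 hβ1 hc hτ ha0 hζ) j k
  simpa only [FormalMultilinearSeries.coeff_ofScalars, ← hwseq] using h
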